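/- arXiv:1202.1897 — 2 statements merged into one kernel-verified Lean document; each statement's English description precedes it below -/
import Mathlib

section
/- Let R be a commutative ring and let x ∈ R be an element that is neither a unit nor a zero divisor, and set R* = R/(x). Let M be an R-module on which x is regular, i.e., multiplication by x is injective on M. Then for every R*-module L* and every natural number n ≥ 0 there is an isomorphism of abelian groups Ext^n_{R*}(L*, M/xM) ≅ Ext^{n+1}_R(L*, M), where on the right-hand side L* is regarded as an R-module via the quotient map R → R*. -/
open CategoryTheory Pointwise

universe w v u

section

open Abelian Limits

namespace CategoryTheory.ProjectiveResolution

variable {C : Type u} [Category.{v} C] [Abelian C] {X : C} (P : ProjectiveResolution X) (Y : C)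

lemma extMk_eq_zero_iff_of_degree_zero [HasExt.{w} C] {Y : C} (f : P.complex.X 0 ⟶ Y) (m : ℕ)
    (hm : 0 + 1 = m) (hf : P.complex.d m 0 ≫ f = 0) : P.extMk f m hm hf = 0 ↔ f = 0 := by
  refine ⟨fun h ↦ ?_, by rintro rfl; simp⟩
  rw [← P.extEquivCohomologyClass.apply_eq_iff_eq, extEquivCohomologyClass_extMk,
    extEquivCohomologyClass_zero, CochainComplex.HomComplex.CohomologyClass.mk_eq_zero_iff,
    CochainComplex.HomComplex.Cocycle.toSingleMk_mem_coboundaries_iff _ _ _ _ _ 1 (by simp)] at h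
  obtain ⟨g, hg⟩ := h
  rw [← cancel_epi (P.cochainComplexXIso (-(0 : ℕ)) 0 rfl).hom, ← hg,
    (P.cochainComplex.isZero_of_isStrictlyLE 0 1 (by simp)).eq_zero_of_src g]
  simp

/-- The cocycles of degree `n` in the complex of morphisms from a projective resolution of `X`
to `Y`, mapped to their classes in `Ext X Y n`. -/
noncomputable def extClassOfCocycle [HasExt.{w} C] (k : Type*) [Ring k] [Linear k C] (n : ℕ) :
    LinearMap.ker ((P.complex.linearYonedaObj k Y).sc n).g.hom →+ Ext X Y n where
  toFun f := P.extMk f.1 ((ComplexShape.up ℕ).next n) (by simp) f.2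
  map_zero' := by exact P.extMk_zero _ (by simp)
  map_add' f g := (P.add_extMk f.1 g.1 _ (by simp) f.2 g.2).symm

lemma extClassOfCocycle_surjective [HasExt.{w} C] (k : Type*) [Ring k] [Linear k C] (n : ℕ) :
    Function.Surjective (P.extClassOfCocycle Y k n) := fun α ↦ by
  obtain ⟨f, hf, rfl⟩ := P.extMk_surjective α ((ComplexShape.up ℕ).next n) (by simp)
  exact ⟨⟨f, hf⟩, rfl⟩

lemma extClassOfCocycle_eq_zero_iff [HasExt.{w} C] (k : Type*) [Ring k] [Linear k C] (n : ℕ)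
    (f : LinearMap.ker ((P.complex.linearYonedaObj k Y).sc n).g.hom) :
    P.extClassOfCocycle Y k n f = 0 ↔
      f ∈ LinearMap.range ((P.complex.linearYonedaObj k Y).sc n).moduleCatToCycles := by
  obtain ⟨f, hf⟩ := f
  cases n with
  | zero =>
    have h : ((P.complex.linearYonedaObj k Y).sc 0).f = 0 :=
      (P.complex.linearYonedaObj k Y).shape _ _ (by simp)
    refine (P.extMk_eq_zero_iff_of_degree_zero f _ (by simp) hf).trans ?_
    have h' (y) : (((P.complex.linearYonedaObj k Y).sc 0).moduleCatToCycles y).1 = 0 := by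
      change ((P.complex.linearYonedaObj k Y).sc 0).f.hom y = 0
      rw [h, ModuleCat.hom_zero, LinearMap.zero_apply]
    simp only [LinearMap.mem_range, Subtype.ext_iff]
    exact ⟨fun hf0 ↦ ⟨0, (h' 0).trans hf0.symm⟩, fun ⟨y, hy⟩ ↦ hy.symm.trans (h' y)⟩
  | succ p =>
    refine (P.extMk_eq_zero_iff f _ (by simp) hf ((ComplexShape.up ℕ).prev (p + 1))
      (by simp)).trans ?_
    simp only [LinearMap.mem_range, Subtype.ext_iff]
    rfl

end CategoryTheory.ProjectiveResolution

/-- Two quotients of an additive group by the same subgroup are isomorphic. -/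
lemma AddMonoidHom.nonempty_addEquiv_of_surjective {G A B : Type*} [AddGroup G] [AddGroup A]
    [AddGroup B] {a : G →+ A} {b : G →+ B} (ha : Function.Surjective a)
    (hb : Function.Surjective b) (h : a.ker = b.ker) : Nonempty (A ≃+ B) :=
  ⟨((QuotientAddGroup.quotientKerEquivOfSurjective a ha).symm.trans
    (QuotientAddGroup.quotientAddEquivOfEq h)).trans
      (QuotientAddGroup.quotientKerEquivOfSurjective b hb)⟩

/-- The `Ext` groups defined as derived functors of `Hom` are isomorphic to those defined in terms
of the derived category. -/
theorem nonempty_ext_addEquiv_abelianExt {C : Type u} [Category.{v} C] [Abelian C]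
    [EnoughProjectives C] [HasExt.{w} C] (k : Type*) [Ring k] [Linear k C] (X Y : C) (n : ℕ) :
    Nonempty (((_root_.Ext k C n).obj (Opposite.op X)).obj Y ≃+ Abelian.Ext.{w} X Y n) := by
  let P := projectiveResolution X
  let S := (P.complex.linearYonedaObj k Y).sc n
  obtain ⟨e⟩ := AddMonoidHom.nonempty_addEquiv_of_surjective
    (a := (LinearMap.range S.moduleCatToCycles).mkQ.toAddMonoidHom)
    (b := P.extClassOfCocycle Y k n) (Submodule.mkQ_surjective _)
    (P.extClassOfCocycle_surjective Y k n) (by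
      ext f
      simp only [AddMonoidHom.mem_ker, P.extClassOfCocycle_eq_zero_iff]
      exact Submodule.Quotient.mk_eq_zero _)
  exact ⟨(P.isoExt n Y ≪≫ S.moduleCatHomologyIso).toLinearEquiv.toAddEquiv.trans e⟩

/-- A free module over the quotient of `R` by a nonzerodivisor has projective dimension at most
one over `R`. -/
lemma ModuleCat.hasProjectiveDimensionLE_one_of_free_quotient {R : Type u} [CommRing R] {x : R}
    (hx : x ∈ nonZeroDivisors R) (P : Type u) [AddCommGroup P] [Module R P]
    [Module (R ⧸ Ideal.span {x}) P] [IsScalarTower R (R ⧸ Ideal.span {x}) P]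
    [Module.Free (R ⧸ Ideal.span {x}) P] :
    HasProjectiveDimensionLE (ModuleCat.of R P) 1 := by
  let b := Module.Free.chooseBasis (R ⧸ Ideal.span {x}) P
  let ι := Module.Free.ChooseBasisIndex (R ⧸ Ideal.span {x}) P
  let f : (ι →₀ R) →ₗ[R] (ι →₀ R) := LinearMap.lsmul R _ x
  let q : (ι →₀ R) →ₗ[R] (ι →₀ R ⧸ Ideal.span {x}) :=
    Finsupp.mapRange.linearMap (Ideal.span {x}).mkQ
  let g : (ι →₀ R) →ₗ[R] P := (b.repr.symm.toLinearMap.restrictScalars R) ∘ₗ q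
  have hfg : Function.Exact f g := fun l ↦ by
    have hq : g l = 0 ↔ ∀ i, l i ∈ Ideal.span {x} := by
      simp only [g, LinearMap.comp_apply, LinearMap.restrictScalars_apply, LinearEquiv.coe_coe,
        EmbeddingLike.map_eq_zero_iff, Finsupp.ext_iff, q, Finsupp.mapRange.linearMap_apply,
        Finsupp.mapRange_apply, Finsupp.zero_apply, Submodule.mkQ_apply,
        Submodule.Quotient.mk_eq_zero]
    rw [hq]
    refine ⟨fun h ↦ ?_, ?_⟩
    · choose c hc using fun i ↦ Ideal.mem_span_singleton'.mp (h i)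
      refine ⟨Finsupp.onFinset l.support c fun i hi ↦ ?_, ?_⟩
      · rw [Finsupp.mem_support_iff, ← hc i]
        exact fun h0 ↦ hi ((mem_nonZeroDivisors_iff.mp hx).2 _ h0)
      · ext i
        simp [f, ← hc i, mul_comm]
    · rintro ⟨m, rfl⟩ i
      exact Ideal.mem_span_singleton'.mpr ⟨m i, by simp [f, mul_comm]⟩
  have hS : (ModuleCat.shortComplexOfCompEqZero f g hfg.linearMap_comp_eq_zero).ShortExact :=
    ModuleCat.shortComplex_shortExact _ hfg
      (fun a c h ↦ by
        ext i
        have := DFunLike.congr_fun h i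
        exact (mul_cancel_left_mem_nonZeroDivisors hx).mp this)
      (b.repr.symm.surjective.comp
        (Finsupp.mapRange_surjective _ (map_zero _) (Submodule.mkQ_surjective _)))
  have : Projective (ModuleCat.of R (ι →₀ R)) :=
    (ModuleCat.of R (ι →₀ R)).projective_of_categoryTheory_projective
  exact hS.hasProjectiveDimensionLT_X₃ 1
    (inferInstanceAs (HasProjectiveDimensionLT (ModuleCat.of R (ι →₀ R)) 1))
    (inferInstanceAs (HasProjectiveDimensionLT (ModuleCat.of R (ι →₀ R)) 2))

variable {R : Type u} [CommRing R] {x : R}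

namespace ModuleCat

/-- Restriction of scalars along `R → R ⧸ (x)`. -/
noncomputable abbrev restrictQuotient (x : R) :
    ModuleCat.{u} (R ⧸ Ideal.span {x}) ⥤ ModuleCat.{u} R :=
  ModuleCat.restrictScalars (Ideal.Quotient.mk (Ideal.span {x}))

instance : (restrictQuotient x).Full where
  map_surjective {_ _} f := ⟨ModuleCat.ofHom
    { toFun := f.hom
      map_add' := f.hom.map_add
      map_smul' := fun r l ↦ by
        obtain ⟨r, rfl⟩ := Ideal.Quotient.mk_surjective r
        exact f.hom.map_smul r l }, rfl⟩

lemma hasProjectiveDimensionLE_one_restrictQuotient (hx : x ∈ nonZeroDivisors R)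
    (P : ModuleCat.{u} (R ⧸ Ideal.span {x})) [Module.Free (R ⧸ Ideal.span {x}) P] :
    HasProjectiveDimensionLE ((restrictQuotient x).obj P) 1 := by
  let : Module R P := Module.compHom _ (Ideal.Quotient.mk (Ideal.span {x}))
  have : IsScalarTower R (R ⧸ Ideal.span {x}) P := .of_algebraMap_smul fun _ _ ↦ rfl
  exact hasProjectiveDimensionLE_one_of_free_quotient hx P

lemma smul_restrictQuotient_id (L : ModuleCat.{u} (R ⧸ Ideal.span {x})) :
    x • 𝟙 ((restrictQuotient x).obj L) = 0 := by
  ext l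
  change Ideal.Quotient.mk (Ideal.span {x}) x • (show L from l) = 0
  rw [Ideal.Quotient.eq_zero_iff_mem.mpr (Ideal.mem_span_singleton_self x), zero_smul]

lemma smul_ext_restrictQuotient (L : ModuleCat.{u} (R ⧸ Ideal.span {x})) (M : ModuleCat.{u} R)
    (n : ℕ) (e : Ext ((restrictQuotient x).obj L) M n) : x • e = 0 := by
  have h : x • e = (Ext.mk₀ (x • 𝟙 ((restrictQuotient x).obj L))).comp e (zero_add n) := by
    simp [Ext.mk₀_smul]
  rw [h, smul_restrictQuotient_id, Ext.mk₀_zero, Ext.zero_comp]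

variable {M : ModuleCat.{u} R} {N : ModuleCat.{u} (R ⧸ Ideal.span {x})}
  {π : M ⟶ (restrictQuotient x).obj N} {w : (x • 𝟙 M) ≫ π = 0}
  (hS : (ShortComplex.mk (x • 𝟙 M) π w).ShortExact)

/-- The map `Ext^n_{R ⧸ (x)}(L, N) → Ext^{n+1}_R(L, M)`: restriction of scalars followed by the
connecting map of `0 → M → M → N → 0`. -/
noncomputable def extRestrictQuotient (L : ModuleCat.{u} (R ⧸ Ideal.span {x})) (n : ℕ) :
    Ext L N n →+ Ext ((restrictQuotient x).obj L) M (n + 1) :=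
  (hS.extClass.postcomp _ rfl).comp ((restrictQuotient x).mapExtAddHom L N n)

lemma postcomp_extClass_surjective (L : ModuleCat.{u} (R ⧸ Ideal.span {x})) (n : ℕ) :
    Function.Surjective
      (hS.extClass.postcomp ((restrictQuotient x).obj L) (rfl : n + 1 = n + 1)) := fun e ↦
  Ext.covariant_sequence_exact₁ _ hS e
    (by rw [← Ext.smul_eq_comp_mk₀, smul_ext_restrictQuotient]) rfl

lemma extRestrictQuotient_zero_bijective (L : ModuleCat.{u} (R ⧸ Ideal.span {x})) :
    Function.Bijective (extRestrictQuotient hS L 0) := by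
  refine Function.Bijective.comp (f := (restrictQuotient x).mapExtAddHom L N 0)
    (g := hS.extClass.postcomp _ rfl) ⟨?_, postcomp_extClass_surjective hS L 0⟩ ?_
  · refine (injective_iff_map_eq_zero _).mpr fun e he ↦ ?_
    obtain ⟨f, rfl⟩ := Ext.covariant_sequence_exact₃ _ hS e rfl he
    have : f = 0 := Ext.postcomp_mk₀_injective_of_mono _ (x • 𝟙 M) (hf := hS.mono_f) (by
      change f.comp (Ext.mk₀ (x • 𝟙 M)) (add_zero 0) = Ext.comp 0 (Ext.mk₀ (x • 𝟙 M)) (add_zero 0)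
      rw [← Ext.smul_eq_comp_mk₀, smul_ext_restrictQuotient, Ext.zero_comp])
    rw [this, Ext.zero_comp]
  · simpa [Ext.mapExactFunctor₀] using
      ⟨(restrictQuotient x).map_injective, (restrictQuotient x).map_surjective⟩

theorem extRestrictQuotient_bijective (hx : x ∈ nonZeroDivisors R)
    (L : ModuleCat.{u} (R ⧸ Ideal.span {x})) (n : ℕ) :
    Function.Bijective (extRestrictQuotient hS L n) := by
  induction n generalizing L with
  | zero => exact extRestrictQuotient_zero_bijective hS L
  | succ n ih =>
    let T := L.projectiveShortComplex
    have hT : T.ShortExact := L.shortExact_projectiveShortComplex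
    have hT' := hT.map_of_exact (restrictQuotient x)
    have : Projective T.X₂ := T.X₂.projective_of_categoryTheory_projective
    have : Module.Free (R ⧸ Ideal.span {x}) T.X₂ :=
      inferInstanceAs (Module.Free (R ⧸ Ideal.span {x}) (L →₀ Shrink.{u} (R ⧸ Ideal.span {x})))
    have : HasProjectiveDimensionLT (T.map (restrictQuotient x)).X₂ 2 :=
      hasProjectiveDimensionLE_one_restrictQuotient hx T.X₂
    exact AddMonoidHom.bijective_of_surjective_of_bijective_of_right_exact
      ((Ext.mk₀ T.f).precomp N (zero_add n)) (hT.extClass.precomp N (add_comm 1 n))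
      ((Ext.mk₀ ((restrictQuotient x).map T.f)).precomp M (zero_add (n + 1)))
      (hT'.extClass.precomp M (add_comm 1 (n + 1)))
      (extRestrictQuotient hS T.X₂ n) (extRestrictQuotient hS T.X₁ n)
      (extRestrictQuotient hS L (n + 1))
      (by
        ext e
        simp [extRestrictQuotient, Ext.mapExactFunctor_comp, Ext.mapExactFunctor_mk₀,
          Ext.comp_assoc])
      (by
        ext e
        change hT'.extClass.comp ((e.mapExactFunctor (restrictQuotient x)).comp hS.extClass rfl)
            (add_comm 1 (n + 1)) =
          ((hT.extClass.comp e (add_comm 1 n)).mapExactFunctor (restrictQuotient x)).comp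
            hS.extClass rfl
        rw [Ext.mapExactFunctor_comp, Ext.mapExactFunctor_extClass]
        exact (Ext.comp_assoc _ _ _ (add_comm 1 n) rfl (by lia)).symm)
      ((ShortComplex.ab_exact_iff_function_exact _).1
        (Ext.contravariant_sequence_exact₁' hT N n (n + 1) (add_comm 1 n)))
      ((ShortComplex.ab_exact_iff_function_exact _).1
        (Ext.contravariant_sequence_exact₁' hT' M (n + 1) (n + 2) (add_comm 1 (n + 1))))
      (ih _).surjective (ih _)
      (precomp_extClass_surjective_of_projective_X₂ N hT n)
      (fun e ↦ Ext.contravariant_sequence_exact₃ hT' M e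
        (Ext.eq_zero_of_hasProjectiveDimensionLT _ 2 (by lia)) (add_comm 1 (n + 1)))

end ModuleCat

end

/-- **Rees's theorem.** Let `R` be a commutative ring, `x ∈ R` neither a unit nor a zero
divisor, `R* = R/(x)`, and `M` an `R`-module on which `x` is regular. Then for every
`R*`-module `L` and every `n ≥ 0`,
`Ext^n_{R*}(L, M/xM) ≅ Ext^{n+1}_R(L, M)` as abelian groups, where `L` is regarded as an
`R`-module via the quotient map `R → R*`. -/
theorem rees_theorem_ext
    (R : Type) [CommRing R] (x : R)
    (hx_unit : ¬ IsUnit x) (hx_nzd : x ∈ nonZeroDivisors R)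
    (M : Type) [AddCommGroup M] [Module R M]
    (hxM : Function.Injective fun m : M => x • m)
    (L : Type) [AddCommGroup L] [Module (R ⧸ Ideal.span {x}) L]
    (n : ℕ) :
    letI : Module R L := Module.compHom L (Ideal.Quotient.mk (Ideal.span {x}))
    letI : Module (R ⧸ Ideal.span {x}) (M ⧸ x • (⊤ : Submodule R M)) :=
      Module.IsTorsionBySet.module (by
        intro m a
        obtain ⟨z, rfl⟩ := Submodule.Quotient.mk_surjective _ m
        obtain ⟨r, hr⟩ := Ideal.mem_span_singleton'.mp a.2
        rw [← Submodule.Quotient.mk_smul, Submodule.Quotient.mk_eq_zero, ← hr, mul_smul]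
        exact Submodule.smul_mem _ r (Submodule.smul_mem_pointwise_smul z x ⊤ trivial))
    Nonempty
      ((((Ext (R ⧸ Ideal.span {x}) (ModuleCat.{0} (R ⧸ Ideal.span {x})) n).obj
          (Opposite.op (ModuleCat.of (R ⧸ Ideal.span {x}) L))).obj
        (ModuleCat.of (R ⧸ Ideal.span {x}) (M ⧸ x • (⊤ : Submodule R M))))
      ≃+
      (((Ext R (ModuleCat.{0} R) (n + 1)).obj
          (Opposite.op (ModuleCat.of R L))).obj
        (ModuleCat.of R M))) := by
  let : Module R L := Module.compHom L (Ideal.Quotient.mk (Ideal.span {x}))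
  let : Module (R ⧸ Ideal.span {x}) (M ⧸ x • (⊤ : Submodule R M)) :=
    Module.IsTorsionBySet.module (by
      intro m a
      obtain ⟨z, rfl⟩ := Submodule.Quotient.mk_surjective _ m
      obtain ⟨r, hr⟩ := Ideal.mem_span_singleton'.mp a.2
      rw [← Submodule.Quotient.mk_smul, Submodule.Quotient.mk_eq_zero, ← hr, mul_smul]
      exact Submodule.smul_mem _ r (Submodule.smul_mem_pointwise_smul z x ⊤ trivial))
  let π : ModuleCat.of R M ⟶ (ModuleCat.restrictQuotient x).obj
      (ModuleCat.of (R ⧸ Ideal.span {x}) (M ⧸ x • (⊤ : Submodule R M))) :=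
    ModuleCat.ofHom
      { toFun := (x • (⊤ : Submodule R M)).mkQ
        map_add' := map_add _
        map_smul' := fun r m ↦ map_smul (x • (⊤ : Submodule R M)).mkQ r m }
  have hπ : Function.Exact (x • 𝟙 (ModuleCat.of R M)).hom π.hom := fun m ↦
    (Submodule.Quotient.mk_eq_zero _).trans
      ((Submodule.mem_smul_pointwise_iff_exists m x ⊤).trans (by simp))
  have hS : (ShortComplex.mk (x • 𝟙 (ModuleCat.of R M)) π
      (ModuleCat.hom_ext hπ.linearMap_comp_eq_zero)).ShortExact :=
    ModuleCat.shortComplex_shortExact _ hπ hxM (Submodule.mkQ_surjective _)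
  obtain ⟨e⟩ := nonempty_ext_addEquiv_abelianExt (R ⧸ Ideal.span {x})
    (ModuleCat.of (R ⧸ Ideal.span {x}) L)
    (ModuleCat.of (R ⧸ Ideal.span {x}) (M ⧸ x • (⊤ : Submodule R M))) n
  obtain ⟨e'⟩ := nonempty_ext_addEquiv_abelianExt R (ModuleCat.of R L) (ModuleCat.of R M) (n + 1)
  exact ⟨(e.trans (AddEquiv.ofBijective _
    (ModuleCat.extRestrictQuotient_bijective hS hx_nzd _ n))).trans e'.symm⟩
end

section
/- Let R be an integral domain, let V be a finite free R-module, and let q : V → V* = Hom_R(V, R) be an injective R-linear map which is symmetric, i.e., q(u)(v) = q(v)(u) for all u, v ∈ V. Set S = V*/q(V). Then there is a natural isomorphism S ≅ Ext^1_R(S, R). -/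
open CategoryTheory

/-- An augmented chain complex which is exact in all degrees gives a quasi-isomorphism to the
complex concentrated in degree `0`. -/
lemma ChainComplex.quasiIso_toSingle₀Equiv_symm {C : Type*} [Category* C] [Abelian C]
    {K : ChainComplex C ℕ} {Z : C} (p : K.X 0 ⟶ Z) (w : K.d 1 0 ≫ p = 0)
    (hK₀ : (ShortComplex.mk (K.d 1 0) p w).Exact) (hp : Epi p)
    (hK : ∀ n, K.ExactAt (n + 1)) :
    QuasiIso ((ChainComplex.toSingle₀Equiv K Z).symm ⟨p, w⟩) where
  quasiIsoAt n := by
    have hφ := ChainComplex.toSingle₀Equiv_symm_apply_f_zero p w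
    generalize (ChainComplex.toSingle₀Equiv K Z).symm ⟨p, w⟩ = φ at hφ ⊢
    subst hφ
    cases n
    · rw [ChainComplex.quasiIsoAt₀_iff, ShortComplex.quasiIso_iff_of_zeros']
      · exact ⟨hK₀, hp⟩
      · exact K.shape _ _ (by simp)
      all_goals rfl
    · rw [quasiIsoAt_iff_exactAt']
      · exact hK _
      · exact ChainComplex.exactAt_succ_single_obj _ _

namespace CategoryTheory.ShortComplex

open Limits ZeroObject

variable {C : Type*} [Category* C] [Abelian C] (S : ShortComplex C)

/-- The objects of the chain complex `⋯ ⟶ 0 ⟶ S.X₁ ⟶ S.X₂`. -/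
noncomputable def twoTermX : ℕ → C
  | 0 => S.X₂
  | 1 => S.X₁
  | _ + 2 => 0

/-- The differentials of the chain complex `⋯ ⟶ 0 ⟶ S.X₁ ⟶ S.X₂`. -/
noncomputable def twoTermD : ∀ n : ℕ, S.twoTermX (n + 1) ⟶ S.twoTermX n
  | 0 => S.f
  | _ + 1 => 0

/-- The chain complex `⋯ ⟶ 0 ⟶ S.X₁ ⟶ S.X₂`, with `S.X₂` in degree `0`. -/
noncomputable def twoTermComplex : ChainComplex C ℕ :=
  ChainComplex.of S.twoTermX S.twoTermD fun _ => zero_comp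

lemma twoTermComplex_d_one_zero : S.twoTermComplex.d 1 0 = S.f :=
  ChainComplex.of_d S.twoTermX S.twoTermD 0

lemma isZero_twoTermComplex_X (n : ℕ) : IsZero (S.twoTermComplex.X (n + 2)) :=
  isZero_zero C

variable {S}

lemma ShortExact.twoTermComplex_exactAt_succ (hS : S.ShortExact) (n : ℕ) :
    S.twoTermComplex.ExactAt (n + 1) := by
  rw [HomologicalComplex.exactAt_iff' _ (n + 2) (n + 1) n (by simp) (by simp)]
  match n with
  | 0 =>
    have := hS.mono_f
    refine (ShortComplex.exact_iff_mono _
      ((S.isZero_twoTermComplex_X 0).eq_of_src _ _)).2 ?_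
    change Mono (S.twoTermComplex.d 1 0)
    rwa [twoTermComplex_d_one_zero]
  | n + 1 => exact ShortComplex.exact_of_isZero_X₂ _ (S.isZero_twoTermComplex_X n)

/-- A short exact sequence whose first two terms are projective gives a projective resolution
of length one of the third term. -/
noncomputable def ShortExact.projectiveResolution (hS : S.ShortExact)
    [Projective S.X₁] [Projective S.X₂] : ProjectiveResolution S.X₃ where
  complex := S.twoTermComplex
  projective
    | 0 => inferInstanceAs (Projective S.X₂)
    | 1 => inferInstanceAs (Projective S.X₁)
    | n + 2 => (S.isZero_twoTermComplex_X n).projective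
  π := (ChainComplex.toSingle₀Equiv _ _).symm
    ⟨S.g, by rw [twoTermComplex_d_one_zero]; exact S.zero⟩
  quasiIso := by
    refine ChainComplex.quasiIso_toSingle₀Equiv_symm S.g _ ?_ hS.epi_g
      hS.twoTermComplex_exactAt_succ
    refine ShortComplex.exact_of_iso ?_ hS.exact
    refine ShortComplex.isoMk (Iso.refl S.X₁) (Iso.refl S.X₂) (Iso.refl S.X₃) ?_ ?_
    · exact (Category.id_comp _).trans
        (S.twoTermComplex_d_one_zero.trans (Category.comp_id _).symm)
    · exact (Category.id_comp _).trans (Category.comp_id _).symm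

/-- If `0 ⟶ S.X₁ ⟶ S.X₂ ⟶ S.X₃ ⟶ 0` is exact with `S.X₁` and `S.X₂` projective, then
`Ext¹(S.X₃, Y)` is the cokernel of `Hom(S.X₂, Y) ⟶ Hom(S.X₁, Y)`. -/
noncomputable def ShortExact.extOneIso (hS : S.ShortExact)
    [Projective S.X₁] [Projective S.X₂] [EnoughProjectives C] (R : Type*) [Ring R] [Linear R C]
    (Y : C) :
    ((Ext R C 1).obj (Opposite.op S.X₃)).obj Y ≅
      ModuleCat.of R ((S.X₁ ⟶ Y) ⧸ LinearMap.range (Linear.leftComp R Y S.f)) :=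
  let K := hS.projectiveResolution.complex.linearYonedaObj R Y
  hS.projectiveResolution.isoExt 1 Y ≪≫
    K.isoHomologyι 1 2 (by simp) (by
      ext (x : S.X₁ ⟶ Y)
      exact (S.isZero_twoTermComplex_X 0).eq_of_src _ _) ≪≫
    K.opcyclesIsoSc' 0 1 2 (by simp) (by simp) ≪≫
    (K.sc' 0 1 2).moduleCatOpcyclesIso ≪≫
    (Submodule.quotEquivOfEq _ _ (by
      change LinearMap.range (Linear.leftComp R Y (S.twoTermComplex.d 1 0)) = _
      rw [twoTermComplex_d_one_zero]
      rfl)).toModuleIso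

end CategoryTheory.ShortComplex

/-- The identification of morphisms in `ModuleCat R` with linear maps sends the image of
precomposition with `f` to the image of the dual map of `f`. -/
lemma ModuleCat.map_range_leftComp.{u} {R : Type u} [CommRing R] {M N : Type u} [AddCommGroup M]
    [Module R M] [AddCommGroup N] [Module R N] (f : M →ₗ[R] N) :
    (LinearMap.range (Linear.leftComp R (ModuleCat.of R R) (ModuleCat.ofHom f))).map
      (ModuleCat.homLinearEquiv (S := R) (M := ModuleCat.of R M)
        (N := ModuleCat.of R R)).toLinearMap = LinearMap.range f.dualMap := by
  ext x
  constructor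
  · rintro ⟨_, ⟨g, rfl⟩, rfl⟩
    exact ⟨g.hom, rfl⟩
  · rintro ⟨g, rfl⟩
    exact ⟨_, ⟨ModuleCat.ofHom g, rfl⟩, rfl⟩

/-- For an injective symmetric map `q : V → V*` on a finite free module over a domain,
the cokernel `S = V*/q(V)` satisfies `S ≅ Ext¹_R(S, R)`. -/
theorem cokernel_selfdual_ext_iso
    (R : Type) [CommRing R] [IsDomain R]
    (V : Type) [AddCommGroup V] [Module R V] [Module.Finite R V] [Module.Free R V]
    (q : V →ₗ[R] (V →ₗ[R] R))
    (hinj : Function.Injective q)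
    (hsymm : ∀ u v : V, q u v = q v u) :
    Nonempty
      (((V →ₗ[R] R) ⧸ LinearMap.range q) ≃ₗ[R]
        (((Ext R (ModuleCat.{0} R) 1).obj
            (Opposite.op (ModuleCat.of R ((V →ₗ[R] R) ⧸ LinearMap.range q)))).obj
          (ModuleCat.of R R))) := by
  let S := ShortComplex.moduleCatMk q (LinearMap.range q).mkQ (LinearMap.range_mkQ_comp q)
  have hS : S.ShortExact := ModuleCat.shortComplex_shortExact S
    (LinearMap.exact_map_mkQ_range q) hinj (Submodule.mkQ_surjective _)
  have : Projective S.X₁ := ModuleCat.projective_of_free (Module.Free.chooseBasis R V)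
  have : Projective S.X₂ :=
    ModuleCat.projective_of_free (Module.Free.chooseBasis R (Module.Dual R V))
  have hq : LinearMap.range q.dualMap = LinearMap.range q := by
    rw [← LinearEquiv.range_comp (Module.evalEquiv R V) q.dualMap]
    congr 1
    ext u v
    exact hsymm v u
  refine ⟨LinearEquiv.symm ((hS.extOneIso R (ModuleCat.of R R)).toLinearEquiv ≪≫ₗ
    Submodule.Quotient.equiv _ _ ModuleCat.homLinearEquiv ?_)⟩
  exact (ModuleCat.map_range_leftComp q).trans hq
end
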